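/- arXiv:2401.11766 — 3 statements merged into one kernel-verified Lean document; each statement's English description precedes it below -/
import Mathlib

section
/- Fix n and a finite set S of indices in {0,…,n−1}. For each k ∈ S let f_k : ℝ^n → ℝ be a smooth (C^∞) function such that: (i) f_k does not depend on the k-th coordinate, i.e. f_k(x) = f_k(z_{{k}}(x)) for all x ∈ ℝ^n; and (ii) for all k, k' ∈ S and all x ∈ ℝ^n with x_k = 0 and x_{k'} = 0 one has f_k(x) = f_{k'}(x). Fix any choice function c assigning to each nonempty subset T ⊆ S an element c(T) ∈ T, and define F : ℝ^n → ℝ by F(x) = Σ_{∅ ≠ T ⊆ S} (−1)^{|T|+1} · f_{c(T)}(z_T(x)), the sum ranging over all nonempty subsets T of S. Then F is smooth, and for every k ∈ S and every x ∈ ℝ^n with x_k = 0 one has F(x) = f_k(x). -/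
/-- `zeroOut T x` is the point of `ℝⁿ` obtained from `x` by replacing every coordinate
whose index lies in `T` by `0`. -/
def zeroOut {n : ℕ} (T : Finset (Fin n)) (x : Fin n → ℝ) : Fin n → ℝ :=
  fun i => if i ∈ T then 0 else x i

/-- Given a compatible family of smooth functions `f k` (each independent of the `k`-th
coordinate, agreeing on pairwise intersections of the coordinate hyperplanes `{x k = 0}`
for `k ∈ S`), the explicit inclusion–exclusion formula
`F x = ∑_{∅ ≠ T ⊆ S} (-1)^{|T|+1} f (c T) (zeroOut T x)`
(for any choice function `c` with `c T ∈ T` for nonempty `T ⊆ S`) defines a smooth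
function which restricts to `f k` on the hyperplane `{x k = 0}` for every `k ∈ S`. -/
theorem smooth_inclusion_exclusion_extension {n : ℕ} (S : Finset (Fin n))
    (f : Fin n → (Fin n → ℝ) → ℝ)
    (hf : ∀ k ∈ S, ContDiff ℝ (⊤ : ℕ∞) (f k))
    (hindep : ∀ k ∈ S, ∀ x : Fin n → ℝ, f k x = f k (zeroOut {k} x))
    (hagree : ∀ k ∈ S, ∀ k' ∈ S, ∀ x : Fin n → ℝ,
      x k = 0 → x k' = 0 → f k x = f k' x)
    (c : Finset (Fin n) → Fin n)
    (hc : ∀ T : Finset (Fin n), T ⊆ S → T.Nonempty → c T ∈ T)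
    (F : (Fin n → ℝ) → ℝ)
    (hF : ∀ x : Fin n → ℝ,
      F x = ∑ T ∈ S.powerset.filter (fun T => T.Nonempty),
        (-1 : ℝ) ^ (T.card + 1) * f (c T) (zeroOut T x)) :
    ContDiff ℝ (⊤ : ℕ∞) F ∧ ∀ k ∈ S, ∀ x : Fin n → ℝ, x k = 0 → F x = f k x := by
  constructor
  · have hFe : F = fun x => ∑ T ∈ S.powerset.filter (fun T => T.Nonempty),
        (-1 : ℝ) ^ (T.card + 1) * f (c T) (zeroOut T x) := funext hF
    rw [hFe]
    refine ContDiff.sum fun T hT => ?_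
    rw [Finset.mem_filter, Finset.mem_powerset] at hT
    refine contDiff_const.mul ((hf _ (hT.1 (hc T hT.1 hT.2))).comp ?_)
    rw [contDiff_pi]
    intro i
    by_cases hi : i ∈ T
    · simpa [zeroOut, hi] using contDiff_const
    · simpa [zeroOut, hi] using contDiff_apply ℝ ℝ i
  · intro k hk x hx
    have h1 : F x = ∑ T ∈ S.powerset.filter (fun T => T.Nonempty),
        (-1 : ℝ) ^ (T.card + 1) * f k (zeroOut T x) := by
      rw [hF]
      refine Finset.sum_congr rfl fun T hT => ?_
      rw [Finset.mem_filter, Finset.mem_powerset] at hT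
      have hcT := hc T hT.1 hT.2
      rw [hagree (c T) (hT.1 hcT) k hk (zeroOut T x) (by simp [zeroOut, hcT])
        (by simp [zeroOut, hx])]
    have h2 : ∑ T ∈ S.powerset, (-1 : ℝ) ^ (T.card + 1) * f k (zeroOut T x) = 0 := by
      rw [← Finset.insert_erase hk, Finset.sum_powerset_insert (Finset.notMem_erase k S),
        ← Finset.sum_add_distrib]
      refine Finset.sum_eq_zero fun T hT => ?_
      have hkT : k ∉ T := fun h =>
        Finset.notMem_erase k S (Finset.mem_powerset.1 hT h)
      have hz : zeroOut (insert k T) x = zeroOut T x := by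
        funext i
        by_cases hi : i = k
        · subst hi
          simp [zeroOut, hx]
        · simp [zeroOut, hi]
      rw [hz, Finset.card_insert_of_notMem hkT]
      ring
    have h3 : S.powerset.filter (fun T => ¬ T.Nonempty) = {∅} := by
      ext T
      simp only [Finset.mem_filter, Finset.mem_powerset, Finset.not_nonempty_iff_eq_empty,
        Finset.mem_singleton]
      exact ⟨fun h => h.2, fun h => ⟨by simp [h], h⟩⟩
    have h4 := Finset.sum_filter_add_sum_filter_not S.powerset (fun T => T.Nonempty)
      (fun T => (-1 : ℝ) ^ (T.card + 1) * f k (zeroOut T x))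
    have h5 : zeroOut ∅ x = x := by
      funext i
      simp [zeroOut]
    rw [h3, h2, ← h1, Finset.sum_singleton, h5] at h4
    simp at h4
    linarith
end

section
/- Fix n and a finite set S of indices in {0,…,n−1}. For each k ∈ S let f_k : ℝ^n → ℝ be a smooth (C^∞) function such that: (i) f_k does not depend on the k-th coordinate, i.e. f_k(x) = f_k(z_{{k}}(x)) for all x ∈ ℝ^n; and (ii) for all k, k' ∈ S and all x ∈ ℝ^n with x_k = 0 and x_{k'} = 0 one has f_k(x) = f_{k'}(x). Then there exists a smooth function F : ℝ^n → ℝ such that for every k ∈ S and every x ∈ ℝ^n with x_k = 0 one has F(x) = f_k(x); that is, the compatible family of smooth functions given on the coordinate hyperplanes {x_k = 0}, k ∈ S, admits a simultaneous smooth extension to all of ℝ^n. -/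
/-- A compatible family of smooth functions on the coordinate hyperplanes `{x k = 0}`,
`k ∈ S` (each `f k` smooth, independent of the `k`-th coordinate, and agreeing with
`f k'` on `{x k = 0} ∩ {x k' = 0}`) admits a simultaneous smooth extension `F` to all
of `ℝⁿ`: `F` is smooth and restricts to `f k` on the hyperplane `{x k = 0}` for every
`k ∈ S`. -/
theorem exists_smooth_extension_of_hyperplane_family {n : ℕ} (S : Finset (Fin n))
    (f : Fin n → (Fin n → ℝ) → ℝ)
    (hf : ∀ k ∈ S, ContDiff ℝ (⊤ : ℕ∞) (f k))
    (hindep : ∀ k ∈ S, ∀ x : Fin n → ℝ, f k x = f k (zeroOut {k} x))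
    (hagree : ∀ k ∈ S, ∀ k' ∈ S, ∀ x : Fin n → ℝ,
      x k = 0 → x k' = 0 → f k x = f k' x) :
    ∃ F : (Fin n → ℝ) → ℝ, ContDiff ℝ (⊤ : ℕ∞) F ∧
      ∀ k ∈ S, ∀ x : Fin n → ℝ, x k = 0 → F x = f k x := by
  classical
  induction S using Finset.induction_on with
  | empty => exact ⟨fun _ => 0, contDiff_const, by simp⟩
  | insert a S ha ih =>
    obtain ⟨F, hF, hFk⟩ := ih (fun k hk => hf k (Finset.mem_insert_of_mem hk))
      (fun k hk => hindep k (Finset.mem_insert_of_mem hk))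
      (fun k hk k' hk' => hagree k (Finset.mem_insert_of_mem hk) k'
        (Finset.mem_insert_of_mem hk'))
    have hz : ContDiff ℝ (⊤ : ℕ∞) (zeroOut ({a} : Finset (Fin n))) := by
      rw [contDiff_pi]
      intro i
      by_cases h : i ∈ ({a} : Finset (Fin n))
      · simp only [zeroOut, if_pos h]
        exact contDiff_const
      · simp only [zeroOut, if_neg h]
        exact contDiff_apply ℝ ℝ i
    have haS : a ∈ insert a S := Finset.mem_insert_self a S
    refine ⟨fun x => F x + f a x - F (zeroOut {a} x),
      (hF.add (hf a haS)).sub (hF.comp hz), ?_⟩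
    intro k hk x hx
    rcases Finset.mem_insert.1 hk with rfl | hkS
    · have : zeroOut {k} x = x := by
        funext i
        by_cases h : i = k
        · subst h
          simp [zeroOut, hx]
        · simp [zeroOut, h]
      simp [this]
    · have h1 : zeroOut {a} x k = 0 := by simp [zeroOut, hx]
      have h2 : zeroOut {a} x a = 0 := by simp [zeroOut]
      have h3 := hFk k hkS x hx
      have h4 := hFk k hkS _ h1
      have h5 := hagree k hk a haS _ h1 h2
      have h6 := hindep a haS x
      show F x + f a x - F (zeroOut {a} x) = f k x
      linarith
end

section
/- Let M be a proper metric space, A ⊆ M a closed subset, and δ > 0, δ' > 0 real numbers. Suppose there exists a continuous map r : C → M defined on the closed δ-neighbourhood C = {x ∈ M : dist(x, A) ≤ δ} of A such that for every x ∈ C one has r(x) ∈ A and dist(x, r(x)) ≤ δ', and r(a) = a for every a ∈ A (a retraction onto A of displacement at most δ'). Let f : M → ℝ be a continuous function such that the set {a ∈ A : f(a) ≤ 1 + 2δ} is compact. Then there exists a continuous function G : M → ℝ such that G(a) = f(a) for all a ∈ A and the sublevel set {x ∈ M : G(x) ≤ 1 + δ} is compact. -/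
/-- Let `M` be a proper metric space, `A ⊆ M` closed, and `δ, δ' > 0`. Suppose `r` is a
continuous retraction of the closed `δ`-neighbourhood `C = {x | infDist x A ≤ δ}` onto
`A` of displacement at most `δ'` (i.e. `r` is continuous on `C`, maps `C` into `A`,
moves points a distance at most `δ'`, and fixes `A` pointwise). If `f : M → ℝ` is
continuous and `{a ∈ A | f a ≤ 1 + 2δ}` is compact, then there is a continuous
`G : M → ℝ` agreeing with `f` on `A` whose sublevel set `{x | G x ≤ 1 + δ}` is
compact. -/
theorem exists_proper_extension_of_retraction {M : Type*} [MetricSpace M] [ProperSpace M]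
    (A : Set M) (hA : IsClosed A) (δ δ' : ℝ) (hδ : 0 < δ) (hδ' : 0 < δ')
    (r : M → M)
    (hr_cont : ContinuousOn r {x : M | Metric.infDist x A ≤ δ})
    (hr_mem : ∀ x ∈ {x : M | Metric.infDist x A ≤ δ}, r x ∈ A)
    (hr_disp : ∀ x ∈ {x : M | Metric.infDist x A ≤ δ}, dist x (r x) ≤ δ')
    (hr_fix : ∀ a ∈ A, r a = a)
    (f : M → ℝ) (hf : Continuous f)
    (hcompact : IsCompact {a ∈ A | f a ≤ 1 + 2 * δ}) :
    ∃ G : M → ℝ, Continuous G ∧ (∀ a ∈ A, G a = f a) ∧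
      IsCompact {x : M | G x ≤ 1 + δ} := by
  rcases isEmpty_or_nonempty M with hM | ⟨⟨p⟩⟩
  · exact ⟨f, hf, fun _ _ => rfl, by
      rw [Set.eq_empty_of_isEmpty {x : M | f x ≤ 1 + δ}]; exact isCompact_empty⟩
  obtain ⟨R, hR⟩ := hcompact.isBounded.subset_closedBall p
  -- Outside a large ball we raise `f` to at least `1 + 2δ`; this changes nothing on `A`.
  have hG : Continuous (fun x => f x +
      min 1 (max 0 (dist x p - R)) * max 0 (1 + 2 * δ - f x)) := by fun_prop
  refine ⟨_, hG, ?_, ?_⟩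
  · intro a ha
    by_cases h : f a ≤ 1 + 2 * δ
    · have h1 : dist a p ≤ R := hR ⟨ha, h⟩
      have h2 : max 0 (dist a p - R) = 0 := max_eq_left (by linarith)
      simp [h2]
    · have h2 : max 0 (1 + 2 * δ - f a) = 0 := max_eq_left (by linarith)
      simp [h2]
  · refine (isCompact_closedBall p (R + 1)).of_isClosed_subset
      (isClosed_le hG continuous_const) ?_
    intro x hx
    by_contra hc
    rw [Metric.mem_closedBall, not_le] at hc
    have h1 : min 1 (max 0 (dist x p - R)) = 1 :=
      min_eq_left (le_max_of_le_right (by linarith))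
    simp only [Set.mem_setOf_eq, h1, one_mul] at hx
    have h2 := le_max_right 0 (1 + 2 * δ - f x)
    linarith
end
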